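/- arXiv:1811.05538 — 3 statements merged into one kernel-verified Lean document; each statement's English description precedes it below -/
import Mathlib

section
/- Let E be an arbitrary subset of ℝⁿ, f : E → ℝ a function, and G : E ⇉ ℝⁿ a set-valued map such that G(x) is nonempty, compact and convex for every x ∈ E. Then there exists a convex function F : ℝⁿ → ℝ with F(x) = f(x) and ∂F(x) = G(x) for every x ∈ E if and only if the following three conditions hold. (C): f(x) ≥ f(y) + ⟨y*, x − y⟩ for all x, y ∈ E and y* ∈ G(y). (EX): whenever (y_k) ⊂ E and y_k* ∈ G(y_k) satisfy lim_k |y_k*| = +∞, one has lim_k (⟨y_k, y_k*⟩ − f(y_k))/|y_k*| = +∞. (SCS): whenever x ∈ E, (y_k) ⊂ E, y_k* ∈ G(y_k) with (y_k*) bounded and lim_k (f(x) − f(y_k) − ⟨y_k*, x − y_k⟩) = 0, there exists a sequence (x_k*) ⊂ G(x) with lim_k |x_k* − y_k*| = 0. -/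
open Filter Topology
open scoped RealInnerProductSpace

section SupportingAffineFunctions

variable {V : Type*} [NormedAddCommGroup V] [InnerProductSpace ℝ V]

/-- Superlinear growth of the conjugate of a finite convex function along its subgradients. -/
lemma tendsto_conjugate_div_norm_of_subgradients [FiniteDimensional ℝ V] {F : V → ℝ}
    (hF : ConvexOn ℝ Set.univ F) {y p : ℕ → V}
    (hp : ∀ k z, F (y k) + ⟪p k, z - y k⟫ ≤ F z)
    (hinf : Tendsto (fun k => ‖p k‖) atTop atTop) :
    Tendsto (fun k => (⟪y k, p k⟫ - F (y k)) / ‖p k‖) atTop atTop := by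
  have hcont : ContinuousOn F Set.univ := hF.continuousOn isOpen_univ
  rw [tendsto_atTop]
  intro R
  obtain ⟨B, hB⟩ := (isCompact_closedBall (0 : V) (|R| + 1)).bddAbove_image
    (hcont.mono (Set.subset_univ _))
  filter_upwards [hinf.eventually_ge_atTop (max B 1)] with k hk
  have hk1 : 1 ≤ ‖p k‖ := (le_max_right _ _).trans hk
  have hkB : B ≤ ‖p k‖ := (le_max_left _ _).trans hk
  have hpos : 0 < ‖p k‖ := by linarith
  set z : V := ((|R| + 1) / ‖p k‖) • p k with hz
  have hzB : F z ≤ B := by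
    refine hB ⟨z, ?_, rfl⟩
    rw [mem_closedBall_zero_iff, hz, norm_smul, Real.norm_of_nonneg (by positivity)]
    field_simp
    exact le_rfl
  have hzp : ⟪p k, z⟫ = (|R| + 1) * ‖p k‖ := by
    rw [hz, inner_smul_right, real_inner_self_eq_norm_sq]
    field_simp
  have h := hp k z
  rw [inner_sub_right, hzp, real_inner_comm] at h
  rw [le_div_iff₀ hpos]
  nlinarith [le_abs_self R]

/-- Asymptotic closedness of the subdifferential of a function at a point. -/
lemma exists_subgradients_tendsto_of_approx [FiniteDimensional ℝ V] {F : V → ℝ} {x : V}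
    {y p : ℕ → V} {S : Set V} (hS : {q : V | ∀ z, F x + ⟪q, z - x⟫ ≤ F z} = S)
    (hne : S.Nonempty) (hcomp : IsCompact S)
    (hp : ∀ k z, F (y k) + ⟪p k, z - y k⟫ ≤ F z)
    (hbdd : Bornology.IsBounded (Set.range p))
    (hlim : Tendsto (fun k => F x - F (y k) - ⟪p k, x - y k⟫) atTop (𝓝 0)) :
    ∃ q : ℕ → V, (∀ k, q k ∈ S) ∧ Tendsto (fun k => ‖q k - p k‖) atTop (𝓝 0) := by
  choose q hqS hq using fun k => hcomp.exists_infDist_eq_dist hne (p k)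
  refine ⟨q, hqS, ?_⟩
  have heq : (fun k => ‖q k - p k‖) = fun k => Metric.infDist (p k) S := by
    funext k
    rw [hq k, dist_comm, dist_eq_norm]
  rw [heq]
  refine tendsto_of_subseq_tendsto fun ns hns => ?_
  obtain ⟨a, -, φ, hφ, ha⟩ := tendsto_subseq_of_bounded hbdd
    (x := fun k => p (ns k)) fun k => Set.mem_range_self _
  refine ⟨φ, ?_⟩
  have haS : a ∈ S := by
    rw [← hS]
    intro z
    have hsub := hlim.comp (hns.comp hφ.tendsto_atTop)
    have hl := (tendsto_const_nhds (x := F x)).add (ha.inner (tendsto_const_nhds (x := z - x)))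
    have hl' := hl.sub hsub
    rw [sub_zero] at hl'
    refine le_of_tendsto' hl' fun k => ?_
    have h := hp (ns (φ k)) z
    simp only [Function.comp_apply, inner_sub_right] at h ⊢
    linarith
  have := ((Metric.continuous_infDist_pt S).tendsto a).comp ha
  rwa [Metric.infDist_zero_of_mem haS] at this

variable {E : Set V} {f : V → ℝ} {G : V → Set V}

/-- The value at `z` of the supremum of the affine functions `f y + ⟪p, · - y⟫`,
with `y ∈ E` and `p ∈ G y`. -/
noncomputable def minimalExtension (E : Set V) (f : V → ℝ) (G : V → Set V) (z : V) : ℝ :=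
  ⨆ i : {i : V × V // i.1 ∈ E ∧ i.2 ∈ G i.1}, f i.1.1 + ⟪i.1.2, z - i.1.1⟫

/-- Slopes of affine minorants that are not too small at points of a bounded set are bounded. -/
lemma exists_norm_le_of_le_affine
    (hEX : ∀ y p : ℕ → V, (∀ k, y k ∈ E) → (∀ k, p k ∈ G (y k)) →
      Tendsto (fun k => ‖p k‖) atTop atTop →
      Tendsto (fun k => (⟪y k, p k⟫ - f (y k)) / ‖p k‖) atTop atTop) (R C : ℝ) :
    ∃ M, ∀ y ∈ E, ∀ p ∈ G y, ∀ z, ‖z‖ ≤ R → C ≤ f y + ⟪p, z - y⟫ → ‖p‖ ≤ M := by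
  by_contra! h
  choose y hy p hp z hz hC hM using fun k : ℕ => h k
  have hinf : Tendsto (fun k => ‖p k‖) atTop atTop :=
    tendsto_atTop_mono (fun k => (hM k).le) tendsto_natCast_atTop_atTop
  obtain ⟨k, hk, hk1, hkC⟩ := ((hEX y p hy hp hinf).eventually_ge_atTop (R + 1) |>.and
    ((hinf.eventually_gt_atTop 0).and (hinf.eventually_gt_atTop (-C)))).exists
  rw [le_div_iff₀ hk1] at hk
  have h1 := hC k
  have h2 := real_inner_le_norm (p k) (z k)
  have h3 := mul_le_mul_of_nonneg_left (hz k) hk1.le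
  rw [inner_sub_right, real_inner_comm (y k) (p k)] at h1
  linarith

lemma bddAbove_range_affine
    (hC : ∀ x ∈ E, ∀ y ∈ E, ∀ p ∈ G y, f y + ⟪p, x - y⟫ ≤ f x)
    (hEX : ∀ y p : ℕ → V, (∀ k, y k ∈ E) → (∀ k, p k ∈ G (y k)) →
      Tendsto (fun k => ‖p k‖) atTop atTop →
      Tendsto (fun k => (⟪y k, p k⟫ - f (y k)) / ‖p k‖) atTop atTop)
    (hE : E.Nonempty) (z : V) :
    BddAbove (Set.range fun i : {i : V × V // i.1 ∈ E ∧ i.2 ∈ G i.1} =>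
      f i.1.1 + ⟪i.1.2, z - i.1.1⟫) := by
  obtain ⟨x, hx⟩ := hE
  obtain ⟨M, hM⟩ := exists_norm_le_of_le_affine hEX ‖z‖ 0
  refine ⟨max 0 (f x + M * ‖z - x‖), ?_⟩
  rintro _ ⟨⟨⟨y, p⟩, hy, hp⟩, rfl⟩
  simp only at hy hp ⊢
  rcases le_total (f y + ⟪p, z - y⟫) 0 with h | h
  · exact h.trans (le_max_left _ _)
  refine le_trans ?_ (le_max_right _ _)
  have h1 := hC x hx y hy p hp
  have h2 := real_inner_le_norm p (z - x)
  have h3 := mul_le_mul_of_nonneg_right (hM y hy p hp z le_rfl h) (norm_nonneg (z - x))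
  simp only [inner_sub_right] at *
  linarith

lemma affine_le_minimalExtension
    (hbdd : ∀ z : V, BddAbove (Set.range fun i : {i : V × V // i.1 ∈ E ∧ i.2 ∈ G i.1} =>
      f i.1.1 + ⟪i.1.2, z - i.1.1⟫)) {y p : V} (hy : y ∈ E) (hp : p ∈ G y) (z : V) :
    f y + ⟪p, z - y⟫ ≤ minimalExtension E f G z :=
  le_ciSup (hbdd z) ⟨(y, p), hy, hp⟩

lemma minimalExtension_eq
    (hC : ∀ x ∈ E, ∀ y ∈ E, ∀ p ∈ G y, f y + ⟪p, x - y⟫ ≤ f x)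
    (hbdd : ∀ z : V, BddAbove (Set.range fun i : {i : V × V // i.1 ∈ E ∧ i.2 ∈ G i.1} =>
      f i.1.1 + ⟪i.1.2, z - i.1.1⟫)) {x : V} (hx : x ∈ E) (hne : (G x).Nonempty) :
    minimalExtension E f G x = f x := by
  obtain ⟨p, hp⟩ := hne
  have : Nonempty {i : V × V // i.1 ∈ E ∧ i.2 ∈ G i.1} := ⟨⟨(x, p), hx, hp⟩⟩
  refine le_antisymm (ciSup_le fun i => hC x hx _ i.2.1 _ i.2.2) ?_
  simpa using affine_le_minimalExtension hbdd hx hp x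

lemma convexOn_minimalExtension
    (hbdd : ∀ z : V, BddAbove (Set.range fun i : {i : V × V // i.1 ∈ E ∧ i.2 ∈ G i.1} =>
      f i.1.1 + ⟪i.1.2, z - i.1.1⟫))
    (hne : ∃ x ∈ E, (G x).Nonempty) :
    ConvexOn ℝ Set.univ (minimalExtension E f G) := by
  obtain ⟨x, hx, p, hp⟩ := hne
  have : Nonempty {i : V × V // i.1 ∈ E ∧ i.2 ∈ G i.1} := ⟨⟨(x, p), hx, hp⟩⟩
  refine ⟨convex_univ, fun u _ v _ a b ha hb hab => ciSup_le fun i => ?_⟩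
  have hu := mul_le_mul_of_nonneg_left
    (affine_le_minimalExtension hbdd i.2.1 i.2.2 u) ha
  have hv := mul_le_mul_of_nonneg_left
    (affine_le_minimalExtension hbdd i.2.1 i.2.2 v) hb
  obtain rfl : b = 1 - a := by linarith
  simp only [inner_sub_right, inner_add_right, inner_smul_right, smul_eq_mul] at *
  linarith

lemma subgradient_minimalExtension_mem [CompleteSpace V]
    (hC : ∀ x ∈ E, ∀ y ∈ E, ∀ p ∈ G y, f y + ⟪p, x - y⟫ ≤ f x)
    (hEX : ∀ y p : ℕ → V, (∀ k, y k ∈ E) → (∀ k, p k ∈ G (y k)) →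
      Tendsto (fun k => ‖p k‖) atTop atTop →
      Tendsto (fun k => (⟪y k, p k⟫ - f (y k)) / ‖p k‖) atTop atTop)
    {x : V} (hx : x ∈ E)
    (hSCS : ∀ y p : ℕ → V, (∀ k, y k ∈ E) → (∀ k, p k ∈ G (y k)) →
      Bornology.IsBounded (Set.range p) →
      Tendsto (fun k => f x - f (y k) - ⟪p k, x - y k⟫) atTop (𝓝 0) →
      ∃ q : ℕ → V, (∀ k, q k ∈ G x) ∧ Tendsto (fun k => ‖q k - p k‖) atTop (𝓝 0))
    (hne : (G x).Nonempty) (hclosed : IsClosed (G x)) (hconv : Convex ℝ (G x)) {q : V}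
    (hq : ∀ z, f x + ⟪q, z - x⟫ ≤ minimalExtension E f G z) : q ∈ G x := by
  by_contra hqG
  obtain ⟨l, u, hlu, hul⟩ := geometric_hahn_banach_closed_point hconv hclosed hqG
  obtain ⟨v, hv⟩ : ∃ v : V, ∀ w, l w = ⟪w, v⟫ :=
    ⟨(InnerProductSpace.toDual ℝ V).symm l, fun w => by
      rw [real_inner_comm, InnerProductSpace.toDual_symm_apply]⟩
  have : Nonempty {i : V × V // i.1 ∈ E ∧ i.2 ∈ G i.1} :=
    ⟨⟨(x, hne.some), hx, hne.some_mem⟩⟩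
  set t : ℕ → ℝ := fun k => 1 / ((k : ℝ) + 1) with ht
  have ht0 : ∀ k, 0 < t k := fun k => by positivity
  have ht1 : ∀ k, t k ≤ 1 := fun k => by
    simp only [ht]
    rw [div_le_one (by positivity)]
    linarith [(Nat.cast_nonneg k : (0 : ℝ) ≤ k)]
  have htlim : Tendsto t atTop (𝓝 0) := tendsto_one_div_add_atTop_nhds_zero_nat
  have hsel : ∀ k, ∃ y ∈ E, ∃ p ∈ G y,
      f x + t k * ⟪q, v⟫ - t k * t k < f y + ⟪p, x - y⟫ + t k * ⟪p, v⟫ := by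
    intro k
    have h1 := hq (x + t k • v)
    rw [add_sub_cancel_left, inner_smul_right] at h1
    obtain ⟨i, hi⟩ := exists_lt_of_lt_ciSup (lt_of_lt_of_le
      (sub_lt_self _ (mul_pos (ht0 k) (ht0 k))) h1)
    refine ⟨i.1.1, i.2.1, i.1.2, i.2.2, hi.trans_eq ?_⟩
    simp only [inner_sub_right, inner_add_right, inner_smul_right]
    ring
  choose y hy p hp hyp using hsel
  obtain ⟨M, hM⟩ := exists_norm_le_of_le_affine hEX (‖x‖ + ‖v‖) (f x - |⟪q, v⟫| - 1)
  have hpM : ∀ k, ‖p k‖ ≤ M := fun k => by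
    refine hM (y k) (hy k) (p k) (hp k) (x + t k • v) ?_ ?_
    · refine (norm_add_le _ _).trans ?_
      rw [norm_smul, Real.norm_of_nonneg (ht0 k).le]
      nlinarith [ht1 k, norm_nonneg v]
    · have h1 := hyp k
      have h2 : t k * t k ≤ 1 := by nlinarith [ht0 k, ht1 k]
      have h3 : -|⟪q, v⟫| ≤ t k * ⟪q, v⟫ := by
        nlinarith [ht0 k, ht1 k, neg_abs_le ⟪q, v⟫, abs_nonneg ⟪q, v⟫]
      simp only [inner_sub_right, inner_add_right, inner_smul_right] at *
      linarith
  have hslope : ∀ k, ⟪q, v⟫ - t k ≤ ⟪p k, v⟫ := fun k => by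
    have h1 := hyp k
    have h2 := hC x hx (y k) (hy k) (p k) (hp k)
    refine le_of_mul_le_mul_left ?_ (ht0 k)
    linarith
  have hbd : Bornology.IsBounded (Set.range p) := by
    refine isBounded_iff_forall_norm_le.2 ⟨M, ?_⟩
    rintro _ ⟨k, rfl⟩
    exact hpM k
  have hactive : Tendsto (fun k => f x - f (y k) - ⟪p k, x - y k⟫) atTop (𝓝 0) := by
    have hup : Tendsto (fun k => t k * (M * ‖v‖ - ⟪q, v⟫ + t k)) atTop (𝓝 0) := by
      simpa using htlim.mul (htlim.const_add (M * ‖v‖ - ⟪q, v⟫))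
    refine squeeze_zero (fun k => ?_) (fun k => ?_) hup
    · linarith [hC x hx (y k) (hy k) (p k) (hp k)]
    · have h1 := hyp k
      have h2 : ⟪p k, v⟫ ≤ M * ‖v‖ := (real_inner_le_norm _ _).trans
        (mul_le_mul_of_nonneg_right (hpM k) (norm_nonneg v))
      have h3 := mul_le_mul_of_nonneg_left h2 (ht0 k).le
      linarith
  obtain ⟨r, hrG, hr⟩ := hSCS y p hy hp hbd hactive
  have hlim : Tendsto (fun k => ⟪q, v⟫ - t k - ‖r k - p k‖ * ‖v‖) atTop (𝓝 ⟪q, v⟫) := by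
    simpa using (htlim.const_sub ⟪q, v⟫).sub (hr.mul_const ‖v‖)
  have hle : ⟪q, v⟫ ≤ u := le_of_tendsto' hlim fun k => by
    have h1 := hlu (r k) (hrG k)
    have h2 := neg_le_of_abs_le (abs_real_inner_le_norm (r k - p k) v)
    rw [hv] at h1
    rw [inner_sub_left] at h2
    linarith [hslope k]
  rw [hv] at hul
  linarith

end SupportingAffineFunctions

/-- **Theorem 1 (finite-dimensional case).** Existence of a convex extension
`F : ℝⁿ → ℝ` of `f` with prescribed subdifferential `∂F = G` on `E` is
characterized by conditions (C), (EX) and (SCS). -/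
theorem convex_extension_with_prescribed_subdifferential_Rn
    (n : ℕ) (E : Set (EuclideanSpace ℝ (Fin n)))
    (f : EuclideanSpace ℝ (Fin n) → ℝ)
    (G : EuclideanSpace ℝ (Fin n) → Set (EuclideanSpace ℝ (Fin n)))
    (hG : ∀ x ∈ E, (G x).Nonempty ∧ IsCompact (G x) ∧ Convex ℝ (G x)) :
    (∃ F : EuclideanSpace ℝ (Fin n) → ℝ, ConvexOn ℝ Set.univ F ∧
        ∀ x ∈ E, F x = f x ∧
          {p : EuclideanSpace ℝ (Fin n) | ∀ z, F x + ⟪p, z - x⟫ ≤ F z} = G x) ↔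
      ((∀ x ∈ E, ∀ y ∈ E, ∀ p ∈ G y, f y + ⟪p, x - y⟫ ≤ f x) ∧
       (∀ (y : ℕ → EuclideanSpace ℝ (Fin n)) (p : ℕ → EuclideanSpace ℝ (Fin n)),
          (∀ k, y k ∈ E) → (∀ k, p k ∈ G (y k)) →
          Tendsto (fun k => ‖p k‖) atTop atTop →
          Tendsto (fun k => (⟪y k, p k⟫ - f (y k)) / ‖p k‖) atTop atTop) ∧
       (∀ x ∈ E, ∀ (y : ℕ → EuclideanSpace ℝ (Fin n))
          (p : ℕ → EuclideanSpace ℝ (Fin n)),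
          (∀ k, y k ∈ E) → (∀ k, p k ∈ G (y k)) →
          Bornology.IsBounded (Set.range p) →
          Tendsto (fun k => f x - f (y k) - ⟪p k, x - y k⟫) atTop (𝓝 0) →
          ∃ q : ℕ → EuclideanSpace ℝ (Fin n), (∀ k, q k ∈ G x) ∧
            Tendsto (fun k => ‖q k - p k‖) atTop (𝓝 0))) := by
  constructor
  · rintro ⟨F, hF, hFE⟩
    have hsub : ∀ y ∈ E, ∀ p ∈ G y, ∀ z, F y + ⟪p, z - y⟫ ≤ F z := fun y hy p hp => by
      rw [← (hFE y hy).2] at hp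
      exact hp
    refine ⟨fun x hx y hy p hp => ?_, fun y p hy hp hinf => ?_, fun x hx y p hy hp hbdd hlim => ?_⟩
    · rw [← (hFE x hx).1, ← (hFE y hy).1]
      exact hsub y hy p hp x
    · simp only [← fun k => (hFE (y k) (hy k)).1]
      exact tendsto_conjugate_div_norm_of_subgradients hF
        (fun k => hsub (y k) (hy k) (p k) (hp k)) hinf
    · simp only [← (hFE x hx).1, ← fun k => (hFE (y k) (hy k)).1] at hlim
      exact exists_subgradients_tendsto_of_approx (hFE x hx).2 (hG x hx).1 (hG x hx).2.1
        (fun k => hsub (y k) (hy k) (p k) (hp k)) hbdd hlim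
  · rintro ⟨hC, hEX, hSCS⟩
    rcases E.eq_empty_or_nonempty with rfl | hE
    · exact ⟨fun _ => 0, convexOn_const 0 convex_univ, fun x hx => hx.elim⟩
    have hbdd := bddAbove_range_affine hC hEX hE
    refine ⟨minimalExtension E f G,
      convexOn_minimalExtension hbdd (hE.imp fun x hx => ⟨hx, (hG x hx).1⟩), fun x hx => ?_⟩
    obtain ⟨hne, hcomp, hconv⟩ := hG x hx
    have hval := minimalExtension_eq hC hbdd hx hne
    refine ⟨hval, Set.Subset.antisymm (fun q hq => ?_) fun q hq z => ?_⟩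
    · simp only [hval, Set.mem_ofPred_eq] at hq
      exact subgradient_minimalExtension_mem hC hEX hx (hSCS x hx) hne hcomp.isClosed hconv hq
    · rw [hval]
      exact affine_le_minimalExtension hbdd hx hq z
end

section
/- Let E ⊂ ℝⁿ be compact, f : E → ℝ a function, and G : E ⇉ ℝⁿ an upper semicontinuous set-valued map such that G(x) is nonempty, compact and convex for every x ∈ E. Then there exists a convex function F : ℝⁿ → ℝ with F(x) = f(x) and ∂F(x) = G(x) for every x ∈ E if and only if the following two conditions hold. (C): f(x) ≥ f(y) + ⟨y*, x − y⟩ for all x, y ∈ E and y* ∈ G(y). (PCS): for all x, y ∈ E and y* ∈ G(y), if f(x) = f(y) + ⟨y*, x − y⟩ then y* ∈ G(x). -/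
open Filter Topology
open scoped RealInnerProductSpace

/-- The graph of an upper semicontinuous compact-valued map over a compact set is compact. -/
theorem isCompact_graph_of_usc {X Y : Type*} [TopologicalSpace X] [TopologicalSpace Y]
    {E : Set X} (hE : IsCompact E) {G : X → Set Y} (hG : ∀ x ∈ E, IsCompact (G x))
    (husc : ∀ x ∈ E, ∀ W : Set Y, IsOpen W → G x ⊆ W → ∀ᶠ y in 𝓝[E] x, G y ⊆ W) :
    IsCompact {a : X × Y | a.1 ∈ E ∧ a.2 ∈ G a.1} := by
  rw [isCompact_iff_ultrafilter_le_nhds']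
  intro l hl
  have hlE : ∀ᶠ a in (l : Filter (X × Y)), a.1 ∈ E := mem_of_superset hl fun a ha => ha.1
  obtain ⟨x, hx, hlx⟩ := isCompact_iff_ultrafilter_le_nhds'.1 hE (l.map Prod.fst) hlE
  have hfst : Tendsto Prod.fst (l : Filter (X × Y)) (𝓝[E] x) :=
    tendsto_nhdsWithin_iff.2 ⟨hlx, hlE⟩
  have hset : ((l.map Prod.snd : Ultrafilter Y) : Filter Y) ≤ 𝓝ˢ (G x) := by
    intro s hs
    obtain ⟨W, hWo, hGW, hWs⟩ := mem_nhdsSet_iff_exists.1 hs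
    rw [Ultrafilter.mem_coe, Ultrafilter.mem_map, ← Ultrafilter.mem_coe]
    filter_upwards [hfst.eventually (husc x hx W hWo hGW), hl] with a ha haG
    exact hWs (ha haG.2)
  obtain ⟨p, hp, hlp⟩ : ∃ p ∈ G x, ((l.map Prod.snd : Ultrafilter Y) : Filter Y) ≤ 𝓝 p := by
    by_contra! h
    have hd : Disjoint (𝓝ˢ (G x)) ((l.map Prod.snd : Ultrafilter Y) : Filter Y) :=
      (hG x hx).disjoint_nhdsSet_left.2 fun p hp =>
        (Ultrafilter.disjoint_iff_not_le.2 (h p hp)).symm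
    exact (l.map Prod.snd).neBot.ne (disjoint_self.1 (hd.mono_left hset))
  refine ⟨(x, p), ⟨hx, hp⟩, ?_⟩
  have hfst' : Tendsto Prod.fst (l : Filter (X × Y)) (𝓝 x) := hlx
  have hsnd : Tendsto Prod.snd (l : Filter (X × Y)) (𝓝 p) := hlp
  exact hfst'.prodMk_nhds hsnd

section Hilbert

variable {V : Type*} [NormedAddCommGroup V] [InnerProductSpace ℝ V]

/-- A function whose affine minorants have slopes in a bounded set is continuous. -/
theorem continuousOn_of_affine_minorants {E : Set V} {f : V → ℝ} {G : V → Set V}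
    (hne : ∀ x ∈ E, (G x).Nonempty)
    (hb : Bornology.IsBounded {p : V | ∃ x ∈ E, p ∈ G x})
    (hC : ∀ x ∈ E, ∀ y ∈ E, ∀ p ∈ G y, f y + ⟪p, x - y⟫ ≤ f x) : ContinuousOn f E := by
  obtain ⟨K, hK, hKb⟩ := hb.exists_pos_norm_le
  refine (LipschitzOnWith.of_le_add_mul K.toNNReal fun y hy x hx => ?_).continuousOn
  obtain ⟨p, hp⟩ := hne y hy
  have h1 := hC x hx y hy p hp
  have h2 : -(‖p‖ * ‖x - y‖) ≤ ⟪p, x - y⟫ := (abs_le.1 (abs_real_inner_le_norm p (x - y))).1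
  have h3 : ‖p‖ * ‖x - y‖ ≤ K * ‖x - y‖ := by
    gcongr
    exact hKb p ⟨y, hy, hp⟩
  rw [Real.coe_toNNReal K hK.le, dist_comm, dist_eq_norm]
  linarith

/-- The supremum of a compact family of affine functions is attained and convex. -/
theorem exists_convexOn_max_affine {Γ : Set (V × V)} (hΓ : IsCompact Γ) (hne : Γ.Nonempty)
    {f : V → ℝ} (hf : ContinuousOn (fun a : V × V => f a.1) Γ) :
    ∃ m : V → ℝ, ConvexOn ℝ Set.univ m ∧ ∀ z, (∀ a ∈ Γ, f a.1 + ⟪a.2, z - a.1⟫ ≤ m z) ∧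
      ∃ a ∈ Γ, m z = f a.1 + ⟪a.2, z - a.1⟫ := by
  have key : ∀ z : V, ∃ v : ℝ, (∀ a ∈ Γ, f a.1 + ⟪a.2, z - a.1⟫ ≤ v) ∧
      ∃ a ∈ Γ, v = f a.1 + ⟪a.2, z - a.1⟫ := by
    intro z
    have hcont : ContinuousOn (fun a : V × V => f a.1 + ⟪a.2, z - a.1⟫) Γ :=
      hf.add (by fun_prop)
    obtain ⟨a, ha, hmax⟩ := hΓ.exists_isMaxOn hne hcont
    exact ⟨_, fun b hb => hmax hb, a, ha, rfl⟩
  choose m hm using key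
  refine ⟨m, ⟨convex_univ, fun x _ y _ α β hα hβ hαβ => ?_⟩, hm⟩
  obtain ⟨a, ha, hma⟩ := (hm (α • x + β • y)).2
  have hx := mul_le_mul_of_nonneg_left ((hm x).1 a ha) hα
  have hy := mul_le_mul_of_nonneg_left ((hm y).1 a ha) hβ
  simp only [inner_sub_right, inner_add_right, inner_smul_right] at hma hx hy
  rw [hma, smul_eq_mul, smul_eq_mul]
  obtain rfl : β = 1 - α := by linarith
  linarith

/-- A subgradient at `x` of a maximum of affine functions whose active slopes at `x` all lie
in the closed convex set `K` belongs to `K`. -/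
theorem mem_of_subgradient_max_affine [CompleteSpace V] {Γ : Set (V × V)} (hΓ : IsCompact Γ)
    {f m : V → ℝ} (hf : ContinuousOn (fun a : V × V => f a.1) Γ)
    (hle : ∀ z, ∀ a ∈ Γ, f a.1 + ⟪a.2, z - a.1⟫ ≤ m z)
    (hatt : ∀ z, ∃ a ∈ Γ, m z = f a.1 + ⟪a.2, z - a.1⟫) {K : Set V} (hK : IsClosed K)
    (hKc : Convex ℝ K) {x q : V} (hact : ∀ a ∈ Γ, m x = f a.1 + ⟪a.2, x - a.1⟫ → a.2 ∈ K)
    (hq : ∀ z, m x + ⟪q, z - x⟫ ≤ m z) : q ∈ K := by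
  by_contra hqK
  obtain ⟨φ, u, hφK, hφq⟩ := geometric_hahn_banach_closed_point hKc hK hqK
  obtain ⟨v, rfl⟩ := (InnerProductSpace.toDual ℝ V).surjective φ
  simp only [InnerProductSpace.toDual_apply_apply] at hφK hφq
  choose a haΓ ha using fun k : ℕ => hatt (x + (1 / ((k : ℝ) + 1)) • v)
  obtain ⟨b, hb, θ, hθ, hlim⟩ := hΓ.tendsto_subseq haΓ
  have ht : Tendsto (fun k => 1 / ((θ k : ℝ) + 1)) atTop (𝓝 0) :=
    tendsto_one_div_add_atTop_nhds_zero_nat.comp hθ.tendsto_atTop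
  have hlim1 : Tendsto (fun k => (a (θ k)).1) atTop (𝓝 b.1) :=
    (continuous_fst.tendsto b).comp hlim
  have hlim2 : Tendsto (fun k => (a (θ k)).2) atTop (𝓝 b.2) :=
    (continuous_snd.tendsto b).comp hlim
  have hlimf : Tendsto (fun k => f (a (θ k)).1) atTop (𝓝 (f b.1)) :=
    (hf b hb).tendsto.comp
      (tendsto_nhdsWithin_iff.2 ⟨hlim, Eventually.of_forall fun k => haΓ (θ k)⟩)
  have hstep : ∀ k : ℕ, m x + 1 / ((k : ℝ) + 1) * ⟪q, v⟫ ≤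
      f (a k).1 + ⟪(a k).2, x - (a k).1⟫ + 1 / ((k : ℝ) + 1) * ⟪(a k).2, v⟫ := by
    intro k
    have h := hq (x + (1 / ((k : ℝ) + 1)) • v)
    rw [ha k, add_sub_cancel_left, inner_smul_right, add_sub_right_comm, inner_add_right,
      inner_smul_right] at h
    linarith
  have hslope : ∀ k : ℕ, ⟪q, v⟫ ≤ ⟪(a k).2, v⟫ := by
    intro k
    have h1 := hle x (a k) (haΓ k)
    have h2 := hstep k
    have hpos : 0 < 1 / ((k : ℝ) + 1) := by positivity
    exact le_of_mul_le_mul_left (by linarith) hpos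
  have hbv : ⟪q, v⟫ ≤ ⟪b.2, v⟫ :=
    ge_of_tendsto' (hlim2.inner tendsto_const_nhds) fun k => hslope (θ k)
  have hbx : m x + 0 * ⟪q, v⟫ ≤ f b.1 + ⟪b.2, x - b.1⟫ + 0 * ⟪b.2, v⟫ :=
    le_of_tendsto_of_tendsto' (tendsto_const_nhds.add (ht.mul_const _))
      ((hlimf.add (hlim2.inner (tendsto_const_nhds.sub hlim1))).add
        (ht.mul (hlim2.inner tendsto_const_nhds))) fun k => hstep (θ k)
  have hbK := hφK b.2 (hact b hb (le_antisymm (by linarith) (hle x b hb)))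
  rw [real_inner_comm] at hbK hφq
  linarith

end Hilbert

/-- **Theorem 2 (compact case).** For compact `E ⊂ ℝⁿ` and an upper
semicontinuous set-valued map `G` with nonempty compact convex values,
existence of a convex extension `F : ℝⁿ → ℝ` of `f` with `∂F = G` on `E` is
characterized by conditions (C) and (PCS). -/
theorem convex_extension_with_prescribed_subdifferential_Rn_compact
    (n : ℕ) (E : Set (EuclideanSpace ℝ (Fin n))) (hE : IsCompact E)
    (f : EuclideanSpace ℝ (Fin n) → ℝ)
    (G : EuclideanSpace ℝ (Fin n) → Set (EuclideanSpace ℝ (Fin n)))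
    (hG : ∀ x ∈ E, (G x).Nonempty ∧ IsCompact (G x) ∧ Convex ℝ (G x))
    (husc : ∀ x ∈ E, ∀ W : Set (EuclideanSpace ℝ (Fin n)), IsOpen W → G x ⊆ W →
      ∀ᶠ y in 𝓝[E] x, G y ⊆ W) :
    (∃ F : EuclideanSpace ℝ (Fin n) → ℝ, ConvexOn ℝ Set.univ F ∧
        ∀ x ∈ E, F x = f x ∧
          {p : EuclideanSpace ℝ (Fin n) | ∀ z, F x + ⟪p, z - x⟫ ≤ F z} = G x) ↔
      ((∀ x ∈ E, ∀ y ∈ E, ∀ p ∈ G y, f y + ⟪p, x - y⟫ ≤ f x) ∧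
       (∀ x ∈ E, ∀ y ∈ E, ∀ p ∈ G y, f x = f y + ⟪p, x - y⟫ → p ∈ G x)) := by
  constructor
  · rintro ⟨F, -, hF⟩
    have hsub : ∀ y ∈ E, ∀ p ∈ G y, ∀ z, F y + ⟪p, z - y⟫ ≤ F z := by
      intro y hy p hp
      rwa [← (hF y hy).2] at hp
    refine ⟨fun x hx y hy p hp => ?_, fun x hx y hy p hp hxy => ?_⟩
    · rw [← (hF x hx).1, ← (hF y hy).1]
      exact hsub y hy p hp x
    · rw [← (hF x hx).2]
      intro z
      have h := hsub y hy p hp z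
      rw [← (hF x hx).1, ← (hF y hy).1] at hxy
      rw [hxy]
      simp only [inner_sub_right] at h ⊢
      linarith
  · rintro ⟨hC, hP⟩
    rcases E.eq_empty_or_nonempty with rfl | ⟨x₀, hx₀⟩
    · exact ⟨fun _ => 0, convexOn_const 0 convex_univ, by simp⟩
    have hΓ := isCompact_graph_of_usc hE (fun x hx => (hG x hx).2.1) husc
    have hb : Bornology.IsBounded {p | ∃ x ∈ E, p ∈ G x} := by
      refine (hΓ.image continuous_snd).isBounded.subset ?_
      rintro p ⟨x, hx, hp⟩
      exact ⟨(x, p), ⟨hx, hp⟩, rfl⟩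
    have hf := (continuousOn_of_affine_minorants (fun x hx => (hG x hx).1) hb hC).comp
      (s := {a | a.1 ∈ E ∧ a.2 ∈ G a.1}) continuous_fst.continuousOn fun a ha => ha.1
    obtain ⟨p₀, hp₀⟩ := (hG x₀ hx₀).1
    obtain ⟨m, hm, hmax⟩ := exists_convexOn_max_affine hΓ ⟨(x₀, p₀), hx₀, hp₀⟩ hf
    have hmf : ∀ x ∈ E, m x = f x := by
      intro x hx
      obtain ⟨a, ha, hma⟩ := (hmax x).2
      obtain ⟨p, hp⟩ := (hG x hx).1
      refine le_antisymm (hma ▸ hC x hx a.1 ha.1 a.2 ha.2) ?_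
      simpa using (hmax x).1 (x, p) ⟨hx, hp⟩
    refine ⟨m, hm, fun x hx => ⟨hmf x hx, Set.Subset.antisymm ?_ ?_⟩⟩
    · intro q hq
      refine mem_of_subgradient_max_affine hΓ hf (fun z => (hmax z).1) (fun z => (hmax z).2)
        (hG x hx).2.1.isClosed (hG x hx).2.2 (fun a ha h => ?_) hq
      exact hP x hx a.1 ha.1 a.2 ha.2 (hmf x hx ▸ h)
    · intro p hp z
      rw [hmf x hx]
      exact (hmax z).1 (x, p) ⟨hx, hp⟩
end

section
/- Let E = {(0,0)} ∪ {(x, y) ∈ ℝ² : |x| ≥ min{1, e^y}}. For every pair of convex functions ψ : ℝ² → ℝ and η : ℝ → ℝ, if ψ(x, y) = η(x) for all (x, y) ∈ E, then ψ(x, y) = η(x) for all (x, y) ∈ ℝ². -/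
/-- A convex function on `ℝ` that is bounded above is constant. -/
theorem ConvexOn.eq_of_forall_le {f : ℝ → ℝ} (hf : ConvexOn ℝ Set.univ f) {C : ℝ}
    (hC : ∀ t, f t ≤ C) (s t : ℝ) : f s = f t := by
  have key : ∀ s t, f s ≤ f t := by
    intro s t
    by_contra! hlt
    have hpos : 0 < C - f t := by linarith [hC s]
    set l := (f s - f t) / (2 * (C - f t)) with hl
    have hl0 : 0 < l := div_pos (by linarith) (by linarith)
    have hl1 : l ≤ 1 := (div_le_one (by linarith)).2 (by linarith [hC s])
    have hmul : l * (C - f t) = (f s - f t) / 2 := by rw [hl]; field_simp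
    have hconv := hf.2 (Set.mem_univ t) (Set.mem_univ ((s - (1 - l) * t) / l))
      (sub_nonneg.2 hl1) hl0.le (by ring)
    have hpt : (1 - l) * t + l * ((s - (1 - l) * t) / l) = s := by field_simp; ring
    simp only [smul_eq_mul] at hconv
    rw [hpt] at hconv
    nlinarith [mul_le_mul_of_nonneg_left (hC ((s - (1 - l) * t) / l)) hl0.le]
  exact le_antisymm (key s t) (key t s)

/-- If a convex function on `ℝ²` does not depend on the second coordinate outside the strip
`|x| < 1`, then it does not depend on the second coordinate at all. -/
theorem ConvexOn.eq_of_eq_outside_strip {ψ : ℝ × ℝ → ℝ} {η : ℝ → ℝ}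
    (hψ : ConvexOn ℝ Set.univ ψ) (h : ∀ x y, 1 ≤ |x| → ψ (x, y) = η x) (x s t : ℝ) :
    ψ (x, s) = ψ (x, t) := by
  have hline : ConvexOn ℝ Set.univ fun y => ψ (x, y) := by
    refine ⟨convex_univ, fun a _ b _ p q hp hq hpq => ?_⟩
    have hconv := hψ.2 (Set.mem_univ (x, a)) (Set.mem_univ (x, b)) hp hq hpq
    have hx : p * x + q * x = x := by rw [← add_mul, hpq, one_mul]
    simpa [hx] using hconv
  refine hline.eq_of_forall_le
    (C := (η (x + (|x| + 1)) + η (x - (|x| + 1))) / 2) (fun y => ?_) s t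
  have hr := h (x + (|x| + 1)) y (le_abs.2 (Or.inl (by linarith [neg_abs_le x])))
  have hl := h (x - (|x| + 1)) y (le_abs.2 (Or.inr (by linarith [le_abs_self x])))
  have hconv := hψ.2 (Set.mem_univ (x + (|x| + 1), y)) (Set.mem_univ (x - (|x| + 1), y))
    (by norm_num : (0 : ℝ) ≤ 1 / 2) (by norm_num : (0 : ℝ) ≤ 1 / 2) (by norm_num)
  have hpt : (1 / 2 : ℝ) • (x + (|x| + 1), y) + (1 / 2 : ℝ) • (x - (|x| + 1), y) = (x, y) := by
    ext <;> simp <;> ring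
  rw [hpt, hr, hl] at hconv
  simp only [smul_eq_mul] at hconv
  linarith

/-- If two convex functions `ψ : ℝ² → ℝ` and `η : ℝ → ℝ` satisfy
`ψ(x, y) = η(x)` on `E = {(0,0)} ∪ {(x,y) : |x| ≥ min{1, e^y}}`, then
`ψ(x, y) = η(x)` on all of `ℝ²`. -/
theorem convex_eq_on_E_implies_eq_everywhere
    (ψ : ℝ × ℝ → ℝ) (η : ℝ → ℝ)
    (hψ : ConvexOn ℝ Set.univ ψ) (hη : ConvexOn ℝ Set.univ η)
    (h : ∀ p : ℝ × ℝ,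
      p ∈ ({((0 : ℝ), (0 : ℝ))} ∪ {q : ℝ × ℝ | min 1 (Real.exp q.2) ≤ |q.1|}) →
      ψ p = η p.1) :
    ∀ p : ℝ × ℝ, ψ p = η p.1 := by
  rintro ⟨x, y⟩
  have hstrip : ∀ x y, 1 ≤ |x| → ψ (x, y) = η x := fun x y hx =>
    h (x, y) (Or.inr ((min_le_left _ _).trans hx))
  by_cases hx : x = 0
  · subst hx
    exact (hψ.eq_of_eq_outside_strip hstrip 0 y 0).trans (h (0, 0) (Or.inl rfl))
  · refine (hψ.eq_of_eq_outside_strip hstrip x y (Real.log |x|)).trans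
      (h (x, Real.log |x|) (Or.inr ?_))
    exact (min_le_right _ _).trans (Real.exp_log (abs_pos.2 hx)).le
end
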